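/- For every q ∈ K_q and r ∈ K_r one has φ(q,r) ≥ φ(q, R(q)), with equality if and only if r = R(q); in particular φ_q(q) := φ(q, R(q)) = min over r ∈ K_r of φ(q,r). -/

import Mathlib

noncomputable section

open Finset

variable {X Y J : Type*}

/-- `f(u,v) = u·log u − u·log v` with the conventions `f(0,v) = 0` and `f(u,0) = +∞` for `u > 0`,
taking values in the extended reals. -/
def fdiv (u v : ℝ) : EReal :=
  if u = 0 then 0
  else if v = 0 then (⊤ : EReal)
  else ((u * Real.log u - u * Real.log v : ℝ) : EReal)

/-- Marginal `p_x := ∑_y p_{x,y}`. -/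
def margX [Fintype Y] (p : X → Y → ℝ) (x : X) : ℝ := ∑ y, p x y

/-- Marginal `p^y := ∑_x p_{x,y}`. -/
def margY [Fintype X] (p : X → Y → ℝ) (y : Y) : ℝ := ∑ x, p x y

/-- The polytope `K_q`: `q_{j|x} ≥ 0`, `∑_{j∋x} q_{j|x} = 1` for every `x`,
and `q_{j|x} = 0` whenever `x ∉ j`. -/
def Kq [Fintype J] [DecidableEq X] (S : J → Finset X) : Set (J → X → ℝ) :=
  {q | (∀ j x, 0 ≤ q j x) ∧ (∀ x, (∑ j, if x ∈ S j then q j x else 0) = 1) ∧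
    (∀ j x, x ∉ S j → q j x = 0)}

/-- The polytope `K_r`: `r_{j|y} ≥ 0` and `∑_j r_{j|y} = 1` for every `y`. -/
def Kr (J Y : Type*) [Fintype J] : Set (J → Y → ℝ) :=
  {r | (∀ j y, 0 ≤ r j y) ∧ ∀ y, (∑ j, r j y) = 1}

/-- `φ(q,r) := ∑_{x,y,j} p_{x,y} · f(q_{j|x}, r_{j|y})`, extended-real valued. -/
def phi [Fintype X] [Fintype Y] [Fintype J] (p : X → Y → ℝ)
    (q : J → X → ℝ) (r : J → Y → ℝ) : EReal :=
  ∑ x, ∑ y, ∑ j, (p x y : EReal) * fdiv (q j x) (r j y)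

/-- `δ(q,q') := ∑_x p_x ∑_{j∋x} f(q_{j|x}, q'_{j|x})`, extended-real valued. -/
def delta [Fintype X] [Fintype Y] [Fintype J] [DecidableEq X] (p : X → Y → ℝ)
    (S : J → Finset X) (q q' : J → X → ℝ) : EReal :=
  ∑ x, (margX p x : EReal) * ∑ j, (if x ∈ S j then fdiv (q j x) (q' j x) else 0)

/-- `R_{j|y}(q) := ∑_{x∈j} p_{x|y} q_{j|x}`. -/
def Rmap [Fintype X] [Fintype Y] [DecidableEq X] (p : X → Y → ℝ) (S : J → Finset X)
    (q : J → X → ℝ) : J → Y → ℝ :=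
  fun j y => ∑ x, if x ∈ S j then (p x y / margY p y) * q j x else 0

/-- `A_x(r) := ∑_{j∋x} ∏_y (r_{j|y})^{p^{y|x}}` (real powers, with `0^0 = 1`). -/
def Afun [Fintype Y] [Fintype J] [DecidableEq X] (p : X → Y → ℝ) (S : J → Finset X)
    (r : J → Y → ℝ) (x : X) : ℝ :=
  ∑ j, if x ∈ S j then (∏ y, r j y ^ (p x y / margX p x)) else 0

/-- `Q_{j|x}(r) := (∏_y (r_{j|y})^{p^{y|x}}) / A_x(r)` if `x ∈ j`, and `0` otherwise. -/
def Qmap [Fintype Y] [Fintype J] [DecidableEq X] (p : X → Y → ℝ) (S : J → Finset X)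
    (r : J → Y → ℝ) : J → X → ℝ :=
  fun j x => if x ∈ S j then (∏ y, r j y ^ (p x y / margX p x)) / Afun p S r x else 0

open Classical in
/-- `φ_r(r) := −∑_x p_x log A_x(r)`, equal to `+∞` if `A_x(r) = 0` for some `x`. -/
def phiR [Fintype X] [Fintype Y] [Fintype J] [DecidableEq X] (p : X → Y → ℝ)
    (S : J → Finset X) (r : J → Y → ℝ) : EReal :=
  if ∃ x, Afun p S r x = 0 then ⊤
  else (((- ∑ x, margX p x * Real.log (Afun p S r x)) : ℝ) : EReal)

/-- The explicit real-valued formula for `φ_q`: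
`∑_x p_x ∑_{j∋x} q_{j|x} log q_{j|x} − ∑_y p^y ∑_j R_{j|y}(q) log R_{j|y}(q)`
(with the convention `0·log 0 = 0`, automatic since `Real.log 0 = 0`). -/
def phiQexp [Fintype X] [Fintype Y] [Fintype J] [DecidableEq X] (p : X → Y → ℝ)
    (S : J → Finset X) (q : J → X → ℝ) : ℝ :=
  (∑ x, margX p x * ∑ j, if x ∈ S j then q j x * Real.log (q j x) else 0)
    - ∑ y, margY p y * ∑ j, Rmap p S q j y * Real.log (Rmap p S q j y)

/-- The convex corner `K_a := {a : 0 ≤ a_x ≤ A_x(r) (∀x) for some r ∈ K_r}`. -/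
def Ka [Fintype X] [Fintype Y] [Fintype J] [DecidableEq X] (p : X → Y → ℝ)
    (S : J → Finset X) : Set (X → ℝ) :=
  {a | ∃ r ∈ Kr J Y, ∀ x, 0 ≤ a x ∧ a x ≤ Afun p S r x}

open Classical in
/-- `φ_a(a) := −∑_x p_x log a_x`, equal to `+∞` if `a_x = 0` for some `x`. -/
def phiA [Fintype X] [Fintype Y] (p : X → Y → ℝ) (a : X → ℝ) : EReal :=
  if ∃ x, a x = 0 then ⊤
  else (((- ∑ x, margX p x * Real.log (a x)) : ℝ) : EReal)

theorem EReal.sum_eq_top {ι : Type*} (s : Finset ι) (f : ι → EReal) (hf : ∀ i ∈ s, f i ≠ ⊥)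
    {i : ι} (hi : i ∈ s) (htop : f i = ⊤) : ∑ k ∈ s, f k = ⊤ := by
  classical
  have hbot : ∀ t ⊆ s, ∑ k ∈ t, f k ≠ ⊥ := by
    intro t
    induction t using Finset.induction_on with
    | empty => simp
    | insert a t ha ih =>
      intro ht
      rw [Finset.sum_insert ha]
      exact EReal.add_ne_bot_iff.2 ⟨hf a (ht (Finset.mem_insert_self a t)),
        ih ((Finset.subset_insert a t).trans ht)⟩
  rw [← Finset.add_sum_erase s f hi, htop]
  exact EReal.top_add_of_ne_bot (hbot _ (Finset.erase_subset i s))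

theorem EReal.coe_sum_real {ι : Type*} (s : Finset ι) (f : ι → ℝ) :
    ((∑ i ∈ s, f i : ℝ) : EReal) = ∑ i ∈ s, (f i : EReal) := by
  classical
  induction s using Finset.induction_on with
  | empty => simp
  | insert a s ha ih => rw [Finset.sum_insert ha, Finset.sum_insert ha, EReal.coe_add, ih]

theorem sub_lt_mul_log_sub_log {a b : ℝ} (ha : 0 ≤ a) (hb : 0 ≤ b) (hab : 0 < a → 0 < b)
    (hne : a ≠ b) : a - b < a * (Real.log a - Real.log b) := by
  rcases ha.eq_or_lt with rfl | ha
  · simpa using lt_of_le_of_ne hb hne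
  · have hb := hab ha
    have h := Real.log_lt_sub_one_of_pos (div_pos hb ha)
      (fun h => hne ((div_eq_one_iff_eq ha.ne').1 h).symm)
    rw [Real.log_div hb.ne' ha.ne'] at h
    have h' := mul_lt_mul_of_pos_left h ha
    have hcancel : a * (b / a) = b := by field_simp
    linarith

theorem sub_le_mul_log_sub_log {a b : ℝ} (ha : 0 ≤ a) (hb : 0 ≤ b) (hab : 0 < a → 0 < b) :
    a - b ≤ a * (Real.log a - Real.log b) := by
  rcases eq_or_ne a b with rfl | hne
  · simp
  · exact (sub_lt_mul_log_sub_log ha hb hab hne).le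

theorem coe_mul_fdiv {c u v : ℝ} (h : c ≠ 0 → u ≠ 0 → v ≠ 0) :
    (c : EReal) * fdiv u v = ((c * (u * Real.log u - u * Real.log v) : ℝ) : EReal) := by
  by_cases hc : c = 0
  · simp [hc]
  by_cases hu : u = 0
  · simp [hu, fdiv]
  rw [fdiv, if_neg hu, if_neg (h hc hu), EReal.coe_mul]

theorem coe_mul_fdiv_zero_right {c u : ℝ} (hc : 0 < c) (hu : u ≠ 0) :
    (c : EReal) * fdiv u 0 = ⊤ := by
  rw [fdiv, if_neg hu, if_pos rfl, EReal.coe_mul_top_of_pos hc]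

theorem coe_mul_fdiv_ne_bot {c u v : ℝ} (hc : 0 ≤ c) : (c : EReal) * fdiv u v ≠ ⊥ := by
  by_cases h : c ≠ 0 → u ≠ 0 → v ≠ 0
  · rw [coe_mul_fdiv h]
    exact EReal.coe_ne_bot _
  · push Not at h
    obtain ⟨hc0, hu, rfl⟩ := h
    rw [coe_mul_fdiv_zero_right (hc.lt_of_ne' hc0) hu]
    exact top_ne_bot

section Phi

variable [Fintype X] [Fintype Y] {p : X → Y → ℝ} {q : J → X → ℝ} {r : J → Y → ℝ}

theorem phi_eq_coe [Fintype J] (h : ∀ x y j, p x y ≠ 0 → q j x ≠ 0 → r j y ≠ 0) :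
    phi p q r = ((∑ x, ∑ y, ∑ j,
      p x y * (q j x * Real.log (q j x) - q j x * Real.log (r j y)) : ℝ) : EReal) := by
  simp only [phi, EReal.coe_sum_real, coe_mul_fdiv (h _ _ _)]

theorem phi_eq_top [Fintype J] (hp : ∀ x y, 0 ≤ p x y) {x : X} {y : Y} {j : J}
    (hpxy : p x y ≠ 0) (hq : q j x ≠ 0) (hr : r j y = 0) : phi p q r = ⊤ := by
  have hsum : phi p q r =
      ∑ i : X × Y × J, (p i.1 i.2.1 : EReal) * fdiv (q i.2.2 i.1) (r i.2.2 i.2.1) := by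
    simp only [phi, Fintype.sum_prod_type]
  rw [hsum]
  refine EReal.sum_eq_top _ _ (fun i _ => coe_mul_fdiv_ne_bot (hp _ _))
    (Finset.mem_univ (x, y, j)) ?_
  simp only [hr]
  exact coe_mul_fdiv_zero_right ((hp x y).lt_of_ne' hpxy) hq

variable [DecidableEq X] {S : J → Finset X}

theorem margY_mul_Rmap [Fintype J] (hpy : ∀ y, 0 < margY p y) (hq : q ∈ Kq S) (j : J) (y : Y) :
    margY p y * Rmap p S q j y = ∑ x, p x y * q j x := by
  rw [Rmap, Finset.mul_sum]
  refine Finset.sum_congr rfl fun x _ => ?_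
  have hy := (hpy y).ne'
  split_ifs with hx
  · field_simp
  · simp [hq.2.2 j x hx]

theorem Rmap_mem_Kr [Fintype J] (hp : ∀ x y, 0 ≤ p x y) (hpy : ∀ y, 0 < margY p y)
    (hq : q ∈ Kq S) : Rmap p S q ∈ Kr J Y := by
  refine ⟨fun j y => Finset.sum_nonneg fun x _ => ?_, fun y => ?_⟩
  · split_ifs
    · exact mul_nonneg (div_nonneg (hp x y) (hpy y).le) (hq.1 j x)
    · exact le_rfl
  · have hsum : ∀ x, ∑ j, q j x = 1 := fun x => by
      rw [← hq.2.1 x]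
      refine Finset.sum_congr rfl fun j _ => ?_
      split_ifs with hx
      · rfl
      · exact hq.2.2 j x hx
    refine mul_left_cancel₀ (hpy y).ne' ?_
    rw [Finset.mul_sum]
    simp only [margY_mul_Rmap hpy hq]
    rw [Finset.sum_comm]
    simp only [← Finset.mul_sum, hsum, mul_one, margY]

theorem Rmap_ne_zero [Fintype J] (hp : ∀ x y, 0 ≤ p x y) (hpy : ∀ y, 0 < margY p y)
    (hq : q ∈ Kq S) {x : X} {y : Y} {j : J} (hpxy : p x y ≠ 0) (hqjx : q j x ≠ 0) :
    Rmap p S q j y ≠ 0 := by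
  intro h
  have hzero := margY_mul_Rmap hpy hq j y
  rw [h, mul_zero, eq_comm, Finset.sum_eq_zero_iff_of_nonneg
    fun x _ => mul_nonneg (hp x y) (hq.1 j x)] at hzero
  exact mul_ne_zero hpxy hqjx (hzero x (Finset.mem_univ x))

theorem pos_of_Rmap_pos [Fintype J] (hpy : ∀ y, 0 < margY p y) (hq : q ∈ Kq S)
    (hr : r ∈ Kr J Y) (h : ∀ x y j, p x y ≠ 0 → q j x ≠ 0 → r j y ≠ 0) {j : J} {y : Y}
    (hR : 0 < Rmap p S q j y) : 0 < r j y := by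
  have hpos := mul_pos (hpy y) hR
  rw [margY_mul_Rmap hpy hq] at hpos
  obtain ⟨x, -, hx⟩ := Finset.exists_ne_zero_of_sum_ne_zero hpos.ne'
  exact (hr.1 j y).lt_of_ne' (h x y j (left_ne_zero_of_mul hx) (right_ne_zero_of_mul hx))

/-- The excess of `φ(q,·)` at `r` over its value at `R(q)` is a weighted sum of relative
entropies. -/
theorem sum_sub_sum_eq_sum_relative_entropy [Fintype J] (hpy : ∀ y, 0 < margY p y)
    (hq : q ∈ Kq S) (hR : Rmap p S q ∈ Kr J Y) (hr : r ∈ Kr J Y) :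
    (∑ x, ∑ y, ∑ j, p x y * (q j x * Real.log (q j x) - q j x * Real.log (r j y))) -
      (∑ x, ∑ y, ∑ j,
        p x y * (q j x * Real.log (q j x) - q j x * Real.log (Rmap p S q j y))) =
    ∑ y, ∑ j, margY p y * (Rmap p S q j y * (Real.log (Rmap p S q j y) - Real.log (r j y)) -
      (Rmap p S q j y - r j y)) := by
  simp only [← Finset.sum_sub_distrib]
  rw [Finset.sum_comm]
  refine Finset.sum_congr rfl fun y _ => ?_
  rw [Finset.sum_comm]
  have hcorr : ∑ j, margY p y * (Rmap p S q j y - r j y) = 0 := by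
    rw [← Finset.mul_sum, Finset.sum_sub_distrib, hR.2 y, hr.2 y, sub_self, mul_zero]
  simp only [mul_sub (margY p y) (_ * _)]
  rw [Finset.sum_sub_distrib, hcorr, sub_zero]
  refine Finset.sum_congr rfl fun j _ => ?_
  rw [← mul_assoc, margY_mul_Rmap hpy hq, Finset.sum_mul]
  exact Finset.sum_congr rfl fun x _ => by ring

theorem phi_Rmap_le_and_eq_iff [Fintype J] (hp : ∀ x y, 0 ≤ p x y)
    (hpy : ∀ y, 0 < margY p y) (hq : q ∈ Kq S) (hr : r ∈ Kr J Y) :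
    phi p q (Rmap p S q) ≤ phi p q r ∧
      (phi p q r = phi p q (Rmap p S q) ↔ r = Rmap p S q) := by
  have hR := Rmap_mem_Kr hp hpy hq
  have hφR := phi_eq_coe fun x y j => Rmap_ne_zero hp hpy hq (x := x) (y := y) (j := j)
  by_cases h : ∀ x y j, p x y ≠ 0 → q j x ≠ 0 → r j y ≠ 0
  · have hdiff := sum_sub_sum_eq_sum_relative_entropy hpy hq hR hr
    have hpos : ∀ j y, 0 < Rmap p S q j y → 0 < r j y := fun j y =>
      pos_of_Rmap_pos hpy hq hr h
    have hterm : ∀ y j, 0 ≤ margY p y *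
        (Rmap p S q j y * (Real.log (Rmap p S q j y) - Real.log (r j y)) -
          (Rmap p S q j y - r j y)) := fun y j =>
      mul_nonneg (hpy y).le (sub_nonneg.2
        (sub_le_mul_log_sub_log (hR.1 j y) (hr.1 j y) (hpos j y)))
    have hsum := fun y => Finset.sum_nonneg fun j (_ : j ∈ Finset.univ) => hterm y j
    refine ⟨?_, fun heq => ?_, fun heq => by rw [← heq]⟩
    · rw [phi_eq_coe h, hφR, EReal.coe_le_coe_iff, ← sub_nonneg, hdiff]
      exact Finset.sum_nonneg fun y _ => hsum y
    · rw [phi_eq_coe h, hφR, EReal.coe_eq_coe_iff, ← sub_eq_zero, hdiff,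
        Finset.sum_eq_zero_iff_of_nonneg fun y _ => hsum y] at heq
      funext j y
      have hjy := (Finset.sum_eq_zero_iff_of_nonneg fun j _ => hterm y j).1
        (heq y (Finset.mem_univ y)) j (Finset.mem_univ j)
      by_contra hne
      exact (mul_pos (hpy y) (sub_pos.2 (sub_lt_mul_log_sub_log (hR.1 j y) (hr.1 j y)
        (hpos j y) (Ne.symm hne)))).ne' hjy
  · push Not at h
    obtain ⟨x, y, j, hpxy, hqjx, hrjy⟩ := h
    rw [phi_eq_top hp hpxy hqjx hrjy]
    refine ⟨le_top, fun heq => ?_, fun heq => ?_⟩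
    · rw [hφR] at heq
      exact absurd heq.symm (EReal.coe_ne_top _)
    · exact absurd (heq ▸ hrjy) (Rmap_ne_zero hp hpy hq hpxy hqjx)

end Phi

/-- for every `q ∈ K_q` and `r ∈ K_r`, `φ(q,r) ≥ φ(q, R(q))`, with equality iff
`r = R(q)`; in particular `φ_q(q) := φ(q, R(q))` is the minimum of `φ(q,·)` over `K_r`. -/
theorem R_is_optimal (X Y J : Type*) [Fintype X] [Fintype Y] [Fintype J]
    [Nonempty X] [Nonempty Y] [DecidableEq X]
    (p : X → Y → ℝ) (S : J → Finset X)
    (hp : ∀ x y, 0 ≤ p x y) (hptot : ∑ x, ∑ y, p x y = 1)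
    (hpx : ∀ x, 0 < margX p x) (hpy : ∀ y, 0 < margY p y)
    (hcov : ∀ x, ∃ j, x ∈ S j) :
    ∀ q ∈ Kq S,
      (∀ r ∈ Kr J Y,
        phi p q (Rmap p S q) ≤ phi p q r ∧
        (phi p q r = phi p q (Rmap p S q) ↔ r = Rmap p S q)) ∧
      IsLeast ((fun r => phi p q r) '' Kr J Y) (phi p q (Rmap p S q)) := by
  intro q hq
  have hopt := fun r (hr : r ∈ Kr J Y) => phi_Rmap_le_and_eq_iff hp hpy hq hr
  refine ⟨hopt, ⟨Rmap p S q, Rmap_mem_Kr hp hpy hq, rfl⟩, ?_⟩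
  rintro _ ⟨r, hr, rfl⟩
  exact (hopt r hr).1
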